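/- Let $\mathcal{B}$ be a base for a coarse structure $\mathcal{E}$ on $X$, and let $\overline{\mathcal{B}} = \{\bigcap\mathcal{S} : \emptyset\neq\mathcal{S}\subseteq\mathcal{B}_s\}$ where $\mathcal{B}_s = \{(B\cap B^{-1})\cup\Delta_X : B\in\mathcal{B}\}$, ordered by inclusion. Then $\overline{\mathcal{B}}$ is a meet-complete upward directed poset, and the map $\mathbf{d}^\mathcal{B}(x,y) := \bigcap\{D\in\overline{\mathcal{B}}: (x,y)\in D\}$ (with value $\infty$ when no such $D$ exists) is a coarse $\overline{\mathcal{B}}$-metric whose induced coarse structure is $\mathcal{E}$. -/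

import Mathlib

open Set

/-- The diagonal of `X × X`. -/
def relDiag (X : Type*) : Set (X × X) := {p | p.1 = p.2}

/-- The inverse of a relation. -/
def relInv {X : Type*} (A : Set (X × X)) : Set (X × X) := {p | (p.2, p.1) ∈ A}

/-- The product (composition) of two relations. -/
def relComp {X : Type*} (A B : Set (X × X)) : Set (X × X) :=
  {p | ∃ y, (p.1, y) ∈ A ∧ (y, p.2) ∈ B}

/-- A coarse structure on `X`: contains the diagonal, closed under subsets,
inverses, products and finite unions. -/
def IsCoarseStructure {X : Type*} (E : Set (Set (X × X))) : Prop :=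
  relDiag X ∈ E ∧ (∀ A ∈ E, ∀ B, B ⊆ A → B ∈ E) ∧ (∀ A ∈ E, relInv A ∈ E) ∧
  (∀ A ∈ E, ∀ B ∈ E, relComp A B ∈ E) ∧ (∀ A ∈ E, ∀ B ∈ E, A ∪ B ∈ E)

/-- A uniform structure on `X`. -/
def IsUniformStructure {X : Type*} (U : Set (Set (X × X))) : Prop :=
  (∀ V ∈ U, relDiag X ⊆ V) ∧ (∀ V ∈ U, ∀ W, V ⊆ W → W ∈ U) ∧
  (∀ V ∈ U, ∀ W ∈ U, V ∩ W ∈ U) ∧ (∀ V ∈ U, relInv V ∈ U) ∧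
  (∀ V ∈ U, ∃ W ∈ U, relComp W W ⊆ V)

/-- The entourage `D_α = {(x,y) : d(x,y) ≤ α}`. -/
def DD {X I : Type*} [Preorder I] (d : X → X → WithTop I) (α : I) : Set (X × X) :=
  {p | d p.1 p.2 ≤ (α : WithTop I)}

/-- The coarse structure induced by a (coarse) metric: all subsets of the sets `D_α`. -/
def coarseOf {X I : Type*} [Preorder I] (d : X → X → WithTop I) : Set (Set (X × X)) :=
  {A | ∃ α : I, A ⊆ DD d α}

/-- A coarse `I`-metric: symmetric, zero on the diagonal, with a growth map `Φ`. -/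
def IsCoarseMetric {X I : Type*} [Preorder I] [OrderBot I] (d : X → X → WithTop I) : Prop :=
  (∀ x, d x x = ((⊥ : I) : WithTop I)) ∧ (∀ x y, d x y = d y x) ∧
  ∃ Φ : I → I, ∀ α : I, relComp (DD d α) (DD d α) ⊆ DD d (Φ α)

/-- `𝒯_s`: the symmetrization `(A ∩ A⁻¹) ∪ Δ_X` of the members of `𝒯`. -/
def symPart {X : Type*} (T : Set (Set (X × X))) : Set (Set (X × X)) :=
  (fun A => (A ∩ relInv A) ∪ relDiag X) '' T

/-- `\overline{𝒯}`: all intersections of nonempty subfamilies of `𝒯_s`. -/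
def interClos {X : Type*} (T : Set (Set (X × X))) : Set (Set (X × X)) :=
  {C | ∃ S : Set (Set (X × X)), S.Nonempty ∧ S ⊆ symPart T ∧ C = ⋂₀ S}

theorem relDiag_subset_of_mem_interClos {X : Type*} {T : Set (Set (X × X))} {D : Set (X × X)}
    (hD : D ∈ interClos T) : relDiag X ⊆ D := by
  obtain ⟨S, -, hS, rfl⟩ := hD
  refine subset_sInter fun M hM => ?_
  obtain ⟨A, -, rfl⟩ := hS hM
  exact subset_union_right

theorem swap_mem_of_mem_interClos {X : Type*} {T : Set (Set (X × X))} {D : Set (X × X)}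
    (hD : D ∈ interClos T) {x y : X} (h : (x, y) ∈ D) : (y, x) ∈ D := by
  obtain ⟨S, -, hS, rfl⟩ := hD
  intro M hM
  have hxy := h M hM
  obtain ⟨A, -, rfl⟩ := hS hM
  exact hxy.imp And.symm Eq.symm

theorem sInter_mem_interClos {X : Type*} {T S : Set (Set (X × X))} (hne : S.Nonempty)
    (hS : S ⊆ interClos T) : ⋂₀ S ∈ interClos T := by
  refine ⟨{M | M ∈ symPart T ∧ ∃ D ∈ S, D ⊆ M}, ?_, fun M hM => hM.1, ?_⟩
  · obtain ⟨D, hD⟩ := hne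
    obtain ⟨R, ⟨M, hM⟩, hR, rfl⟩ := hS hD
    exact ⟨M, hR hM, _, hD, sInter_subset_of_mem hM⟩
  · refine Subset.antisymm ?_ ?_
    · rintro p hp M ⟨-, D, hD, hDM⟩
      exact hDM (hp D hD)
    · intro p hp D hD
      obtain ⟨R, -, hR, rfl⟩ := hS hD
      exact fun M hM => hp M ⟨hR hM, _, hD, sInter_subset_of_mem hM⟩

theorem IsCoarseStructure.interClos_subset {X : Type*} {E B : Set (Set (X × X))}
    (hE : IsCoarseStructure E) (hBE : B ⊆ E) : interClos B ⊆ E := by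
  rintro D ⟨S, ⟨M, hM⟩, hS, rfl⟩
  obtain ⟨hdiag, hsub, -, -, hunion⟩ := hE
  obtain ⟨A, hA, rfl⟩ := hS hM
  exact hsub _ (hunion A (hBE hA) _ hdiag) _
    ((sInter_subset_of_mem hM).trans (union_subset_union_left _ inter_subset_left))

theorem IsCoarseStructure.exists_mem_interClos_superset {X : Type*} {E B : Set (Set (X × X))}
    (hE : IsCoarseStructure E) (hbase : ∀ A ∈ E, ∃ C ∈ B, A ⊆ C) {A : Set (X × X)}
    (hA : A ∈ E) : ∃ D ∈ interClos B, A ⊆ D := by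
  obtain ⟨-, -, hinv, -, hunion⟩ := hE
  obtain ⟨C, hC, hAC⟩ := hbase _ (hunion A hA _ (hinv A hA))
  refine ⟨_, ⟨{(C ∩ relInv C) ∪ relDiag X}, singleton_nonempty _, ?_, rfl⟩, ?_⟩
  · exact singleton_subset_iff.2 ⟨C, hC, rfl⟩
  · rw [sInter_singleton]
    exact fun p hp => Or.inl ⟨hAC (Or.inl hp), hAC (Or.inr hp)⟩

/-- for a base `ℬ` of a coarse structure `ℰ`, the collection
`\overline{ℬ}` is a meet-complete upward directed poset (ordered by inclusion),
and `dᴮ(x,y) = ⋂ {D ∈ \overline{ℬ} : (x,y) ∈ D}` is a coarse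
`\overline{ℬ}`-metric whose induced coarse structure is `ℰ`. -/
theorem stmt8 {X : Type*} (E : Set (Set (X × X))) (hE : IsCoarseStructure E)
    (B : Set (Set (X × X))) (hBE : B ⊆ E) (hbase : ∀ A ∈ E, ∃ C ∈ B, A ⊆ C)
    (dB : X → X → WithTop (Set (X × X)))
    (hdB1 : ∀ x y : X, (∃ D ∈ interClos B, (x, y) ∈ D) →
      dB x y = ((⋂₀ {D | D ∈ interClos B ∧ (x, y) ∈ D} : Set (X × X)) :
        WithTop (Set (X × X))))
    (hdB2 : ∀ x y : X, (¬ ∃ D ∈ interClos B, (x, y) ∈ D) → dB x y = ⊤) :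
    (∀ S : Set (Set (X × X)), S.Nonempty → S ⊆ interClos B → ⋂₀ S ∈ interClos B) ∧
    (∀ A ∈ interClos B, ∀ C ∈ interClos B, ∃ D ∈ interClos B, A ⊆ D ∧ C ⊆ D) ∧
    (⋂₀ interClos B ∈ interClos B ∧ ∀ D ∈ interClos B, ⋂₀ interClos B ⊆ D) ∧
    (∀ x : X, dB x x = ((⋂₀ interClos B : Set (X × X)) : WithTop (Set (X × X)))) ∧
    (∀ x y : X, dB x y = dB y x) ∧
    (∃ Φ : Set (X × X) → Set (X × X), (∀ D ∈ interClos B, Φ D ∈ interClos B) ∧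
      ∀ D ∈ interClos B, ∀ x y z : X,
        dB x y ≤ (D : WithTop (Set (X × X))) → dB y z ≤ (D : WithTop (Set (X × X))) →
        dB x z ≤ ((Φ D : Set (X × X)) : WithTop (Set (X × X)))) ∧
    (E = {A | ∃ D ∈ interClos B,
      A ⊆ {p : X × X | dB p.1 p.2 ≤ (D : WithTop (Set (X × X)))}}) := by
  have hsub := hE.interClos_subset hBE
  have hcov : ∀ A ∈ E, ∃ D ∈ interClos B, A ⊆ D := fun A hA =>
    hE.exists_mem_interClos_superset hbase hA
  have hdiag : relDiag X ∈ E := hE.1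
  obtain ⟨D₀, hD₀, -⟩ := hcov _ hdiag
  have hle : ∀ D ∈ interClos B, ∀ x y : X,
      dB x y ≤ (D : WithTop (Set (X × X))) ↔ (x, y) ∈ D := by
    intro D hD x y
    by_cases h : ∃ D ∈ interClos B, (x, y) ∈ D
    · rw [hdB1 x y h, WithTop.coe_le_coe]
      exact ⟨fun hi => hi fun C hC => hC.2, fun hxy => sInter_subset_of_mem ⟨hD, hxy⟩⟩
    · rw [hdB2 x y h]
      exact ⟨fun ht => absurd (top_le_iff.1 ht) WithTop.coe_ne_top,
        fun hxy => absurd ⟨D, hD, hxy⟩ h⟩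
  have hswap : ∀ x y : X, ∀ D, (D ∈ interClos B ∧ (x, y) ∈ D) ↔
      (D ∈ interClos B ∧ (y, x) ∈ D) := fun x y D =>
    and_congr_right fun hD =>
      ⟨swap_mem_of_mem_interClos hD, swap_mem_of_mem_interClos hD⟩
  refine ⟨fun S hne hS => sInter_mem_interClos hne hS, ?_,
    ⟨sInter_mem_interClos ⟨D₀, hD₀⟩ Subset.rfl, fun D hD => sInter_subset_of_mem hD⟩,
    ?_, ?_, ?_, ?_⟩
  · intro A hA C hC
    obtain ⟨D, hD, hACD⟩ := hcov _ (hE.2.2.2.2 A (hsub hA) C (hsub hC))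
    exact ⟨D, hD, union_subset_iff.1 hACD⟩
  · intro x
    have hx : ∀ D ∈ interClos B, (x, x) ∈ D := fun D hD =>
      relDiag_subset_of_mem_interClos hD rfl
    have hset : {D | D ∈ interClos B ∧ (x, x) ∈ D} = interClos B :=
      Set.ext fun D => and_iff_left_of_imp (hx D)
    rw [hdB1 x x ⟨D₀, hD₀, hx D₀ hD₀⟩, hset]
  · intro x y
    by_cases h : ∃ D ∈ interClos B, (x, y) ∈ D
    · rw [hdB1 x y h, hdB1 y x ((exists_congr (hswap x y)).1 h), Set.ext (hswap x y)]
    · rw [hdB2 x y h, hdB2 y x (mt (exists_congr (hswap x y)).2 h)]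
  · have hΦ : ∀ D, ∃ F ∈ interClos B, D ∈ interClos B → relComp D D ⊆ F := by
      intro D
      by_cases hD : D ∈ interClos B
      · obtain ⟨F, hF, hDF⟩ := hcov _ (hE.2.2.2.1 D (hsub hD) D (hsub hD))
        exact ⟨F, hF, fun _ => hDF⟩
      · exact ⟨D₀, hD₀, fun h => absurd h hD⟩
    choose Φ hmem hcomp using hΦ
    refine ⟨Φ, fun D _ => hmem D, fun D hD x y z hxy hyz => ?_⟩
    exact (hle _ (hmem D) x z).2
      (hcomp D hD ⟨y, (hle D hD x y).1 hxy, (hle D hD y z).1 hyz⟩)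
  · ext A
    constructor
    · intro hA
      obtain ⟨D, hD, hAD⟩ := hcov A hA
      exact ⟨D, hD, fun p hp => (hle D hD p.1 p.2).2 (hAD hp)⟩
    · rintro ⟨D, hD, hAD⟩
      exact hE.2.1 D (hsub hD) A fun p hp => (hle D hD p.1 p.2).1 (hAD hp)
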